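/- If G is a finite simple triangle-free graph and t ∈ ℕ satisfies Δ(G) ≤ t, then G is (t + 1 − ⌊(1/4)·log₂ t⌋)-choosable, where log₂ denotes the base-2 logarithm of a real number (with log₂ 0 interpreted as 0) and ⌊·⌋ is the floor of a real number. -/

import Mathlib

open SimpleGraph Finset

/-- `G` is `f`-choosable: for every assignment `L` of finite lists of natural numbers with
`|L v| = f v`, there is a proper coloring choosing colors from the lists. -/
def Choosable {V : Type*} (G : SimpleGraph V) (f : V → ℤ) : Prop :=
  ∀ L : V → Finset ℕ, (∀ v, ((L v).card : ℤ) = f v) →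
    ∃ c : V → ℕ, (∀ v, c v ∈ L v) ∧ ∀ x y, G.Adj x y → c x ≠ c y

/-- Existence of kernels. -/
lemma kernel_exists {V : Type*} [DecidableEq V] (G : SimpleGraph V) [DecidableRel G.Adj]
    (A : Finset V) (D : V → V → Prop)
    (hA : ∀ x ∈ A, ∀ y ∈ A, ¬ G.Adj x y)
    (hD : ∀ x y, G.Adj x y → D x y ∨ D y x)
    (hB : ∀ x y, x ∉ A → y ∉ A → D x y) (S : Finset V) :
    ∃ K ⊆ S, (∀ x ∈ K, ∀ y ∈ K, ¬ G.Adj x y) ∧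
      ∀ u ∈ S, u ∉ K → ∃ w ∈ K, G.Adj u w ∧ D u w := by
  induction S using Finset.strongInduction with
  | H S ih =>
    by_cases h : ∀ u ∈ S, u ∉ S ∩ A → ∃ w ∈ S ∩ A, G.Adj u w ∧ D u w
    · exact ⟨S ∩ A, inter_subset_left, fun x hx y hy =>
        hA x (mem_inter.1 hx).2 y (mem_inter.1 hy).2, h⟩
    · push Not at h
      obtain ⟨v, hvS, hvA, hv⟩ := h
      have hvA' : v ∉ A := fun h => hvA (mem_inter.2 ⟨hvS, h⟩)
      obtain ⟨K, hKS, hKi, hK⟩ := ih (S.filter (fun u => u ≠ v ∧ ¬ G.Adj u v))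
        (by
          refine ⟨filter_subset _ _, fun h => ?_⟩
          have := h hvS
          simp at this)
      have hK' : ∀ x ∈ K, x ∈ S ∧ x ≠ v ∧ ¬ G.Adj x v := fun x hx => by
        simpa using hKS hx
      refine ⟨insert v K, ?_, ?_, ?_⟩
      · intro x hx
        rcases mem_insert.1 hx with rfl | hx
        · exact hvS
        · exact (hK' x hx).1
      · intro x hx y hy
        rcases mem_insert.1 hx with rfl | hx <;> rcases mem_insert.1 hy with rfl | hy
        · exact G.irrefl
        · exact fun h => (hK' y hy).2.2 h.symm
        · exact (hK' x (by assumption)).2.2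
        · exact hKi x hx y hy
      · intro u hu huK
        rw [mem_insert, not_or] at huK
        by_cases huv : G.Adj u v
        · refine ⟨v, mem_insert_self _ _, huv, ?_⟩
          by_cases huA : u ∈ A
          · exact (hD u v huv).resolve_right (hv u (mem_inter.2 ⟨hu, huA⟩) huv.symm)
          · exact hB u v huA hvA'
        · obtain ⟨w, hw, h⟩ := hK u (by simp [hu, huK.1, huv]) huK.2
          exact ⟨w, mem_insert_of_mem hw, h⟩

open Classical in
/-- The kernel lemma for list coloring. -/
lemma kernel_color {V : Type*} (G : SimpleGraph V)
    (A : Finset V) (D : V → V → Prop)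
    (hA : ∀ x ∈ A, ∀ y ∈ A, ¬ G.Adj x y)
    (hD : ∀ x y, G.Adj x y → D x y ∨ D y x)
    (hB : ∀ x y, x ∉ A → y ∉ A → D x y) (H : Finset V) :
    ∀ L : V → Finset ℕ,
      (∀ v ∈ H, (H.filter (fun y => G.Adj v y ∧ D v y)).card < (L v).card) →
      ∃ c : V → ℕ, (∀ v ∈ H, c v ∈ L v) ∧ ∀ x ∈ H, ∀ y ∈ H, G.Adj x y → c x ≠ c y := by
  induction H using Finset.strongInduction with
  | H H ih =>
    intro L hL
    rcases H.eq_empty_or_nonempty with rfl | ⟨v0, hv0⟩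
    · exact ⟨fun _ => 0, by simp, by simp⟩
    obtain ⟨α, hα⟩ : (L v0).Nonempty := card_pos.1 (by have := hL v0 hv0; omega)
    obtain ⟨K, hKS, hKi, hK⟩ := kernel_exists G A D hA hD hB (H.filter (fun v => α ∈ L v))
    have hK' : ∀ x ∈ K, x ∈ H ∧ α ∈ L x := fun x hx => by simpa using hKS hx
    obtain ⟨k, hk⟩ : K.Nonempty := by
      by_cases h : v0 ∈ K
      · exact ⟨v0, h⟩
      · obtain ⟨w, hw, _⟩ := hK v0 (by simp [hv0, hα]) h
        exact ⟨w, hw⟩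
    obtain ⟨c, hc, hcp⟩ := ih (H \ K)
      (by
        refine ⟨sdiff_subset, fun h => ?_⟩
        have := h (hK' k hk).1
        simp [hk] at this) (fun v => (L v).erase α)
      (by
        intro v hv
        rw [mem_sdiff] at hv
        have hs : (H \ K).filter (fun y => G.Adj v y ∧ D v y) ⊆
            H.filter (fun y => G.Adj v y ∧ D v y) := filter_subset_filter _ sdiff_subset
        have h1 := hL v hv.1
        by_cases hαv : α ∈ L v
        · obtain ⟨w, hw, hvw⟩ := hK v (by simp [hv.1, hαv]) hv.2
          have hss : (H \ K).filter (fun y => G.Adj v y ∧ D v y) ⊂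
              H.filter (fun y => G.Adj v y ∧ D v y) := by
            refine ⟨hs, fun h => ?_⟩
            have := h (mem_filter.2 ⟨(hK' w hw).1, hvw⟩)
            simp [hw] at this
          have h2 := card_lt_card hss
          rw [card_erase_of_mem hαv]
          omega
        · rw [erase_eq_of_notMem hαv]
          exact (card_le_card hs).trans_lt h1)
    refine ⟨fun v => if v ∈ K then α else c v, ?_, ?_⟩
    · intro v hv
      by_cases h : v ∈ K
      · simp [h, (hK' v h).2]
      · simp only [h, if_false]
        exact mem_of_mem_erase (hc v (mem_sdiff.2 ⟨hv, h⟩))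
    · intro x hx y hy hxy
      by_cases h : x ∈ K <;> by_cases h' : y ∈ K
      · exact absurd hxy (hKi x h y h')
      · simp only [h, h', if_true, if_false]
        exact (ne_of_mem_erase (hc y (mem_sdiff.2 ⟨hy, h'⟩))).symm
      · simp only [h, h', if_true, if_false]
        exact ne_of_mem_erase (hc x (mem_sdiff.2 ⟨hx, h⟩))
      · simp only [h, h', if_false]
        exact hcp x (mem_sdiff.2 ⟨hx, h⟩) y (mem_sdiff.2 ⟨hy, h'⟩) hxy

open Classical in
/-- Edges (as ordered pairs starting in `A`) inside `H`. -/
noncomputable def pairsIn {V : Type*} (G : SimpleGraph V) (A H : Finset V) : Finset (V × V) :=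
  (H ×ˢ H).filter (fun p => p.1 ∈ A ∧ G.Adj p.1 p.2)

open Classical in
/-- Orienting edges. -/
lemma exists_orient {V : Type*} (G : SimpleGraph V)
    (A S : Finset V) (hA : ∀ x ∈ A, ∀ y ∈ A, ¬ G.Adj x y) (hS : S.Nonempty)
    (g : V → ℤ) (hg : ∑ v ∈ S, g v ≤ (pairsIn G A S).card) :
    ∃ H ⊆ S, H.Nonempty ∧ ∃ R : V → V → Prop,
      (∀ x y, R x y → ¬ R y x) ∧ (∀ x y, R x y → G.Adj x y ∧ (x ∈ A ∨ y ∈ A)) ∧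
      ∀ x ∈ H, g x ≤ (H.filter (fun y => R x y)).card := by
  obtain ⟨H, hHmem, hmin⟩ := exists_min_image
    (S.powerset.filter (fun H => H.Nonempty ∧ ∑ v ∈ H, g v ≤ (pairsIn G A H).card))
    Finset.card ⟨S, by simp [hS, hg]⟩
  simp only [mem_filter, mem_powerset] at hHmem hmin
  obtain ⟨hHS, hHne, hH⟩ := hHmem
  have hmin' : ∀ T ⊆ H, T.Nonempty → T ≠ H → ((pairsIn G A T).card : ℤ) < ∑ v ∈ T, g v := by
    intro T hT hTne hTH
    by_contra hcon
    push Not at hcon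
    have := hmin T ⟨hT.trans hHS, hTne, hcon⟩
    exact hTH (eq_of_subset_of_card_le hT this)
  let tt : (Σ v : H, Fin (g v).toNat) → Finset (V × V) := fun q =>
    (pairsIn G A H).filter (fun p => p.1 = q.1 ∨ p.2 = q.1)
  have hall : ∀ s : Finset (Σ v : H, Fin (g v).toNat), s.card ≤ (s.biUnion tt).card := by
    intro s
    rcases s.eq_empty_or_nonempty with rfl | hsne
    · simp
    let T : Finset V := s.image (fun q => (q.1 : V))
    have hTH : T ⊆ H := by
      intro x hx
      obtain ⟨q, _, rfl⟩ := mem_image.1 hx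
      exact q.1.2
    have hsT : (s.card : ℤ) ≤ ∑ v ∈ T, g v := by
      have h1 : s.card = ∑ v ∈ T, (s.filter (fun q => (q.1 : V) = v)).card :=
        card_eq_sum_card_image _ _
      rw [h1]
      push_cast
      refine sum_le_sum fun v hv => ?_
      obtain ⟨q, _, rfl⟩ := mem_image.1 hv
      have hpos : 0 < (g q.1).toNat := lt_of_le_of_lt (Nat.zero_le _) q.2.2
      have h2 : (s.filter (fun q' => (q'.1 : V) = q.1)).card ≤ (g q.1).toNat := by
        have : s.filter (fun q' => (q'.1 : V) = q.1) ⊆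
            (univ : Finset (Fin (g q.1).toNat)).image (fun i => ⟨q.1, i⟩) := by
          rintro ⟨v', i⟩ h
          rw [mem_filter] at h
          obtain rfl : v' = q.1 := Subtype.ext h.2
          exact mem_image.2 ⟨i, mem_univ _, rfl⟩
        exact (card_le_card this).trans (card_image_le.trans (by simp))
      omega
    have hsub : pairsIn G A H ⊆ s.biUnion tt ∪ pairsIn G A (H \ T) := by
      intro p hp
      rw [mem_union]
      by_cases h : p.1 ∈ T ∨ p.2 ∈ T
      · left
        rw [mem_biUnion]
        rcases h with h | h
        · obtain ⟨q, hq, he⟩ := mem_image.1 h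
          exact ⟨q, hq, mem_filter.2 ⟨hp, Or.inl he.symm⟩⟩
        · obtain ⟨q, hq, he⟩ := mem_image.1 h
          exact ⟨q, hq, mem_filter.2 ⟨hp, Or.inr he.symm⟩⟩
      · right
        push Not at h
        simp only [pairsIn, mem_filter, mem_product, mem_sdiff] at hp ⊢
        exact ⟨⟨⟨hp.1.1, h.1⟩, ⟨hp.1.2, h.2⟩⟩, hp.2⟩
    have hcard := (card_le_card hsub).trans (card_union_le _ _)
    have hsum : ∑ v ∈ H \ T, g v + ∑ v ∈ T, g v = ∑ v ∈ H, g v := sum_sdiff hTH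
    have hrest : ((pairsIn G A (H \ T)).card : ℤ) ≤ ∑ v ∈ H \ T, g v := by
      rcases (H \ T).eq_empty_or_nonempty with h | h
      · rw [h]; simp [pairsIn]
      · refine (hmin' _ sdiff_subset h ?_).le
        intro he
        obtain ⟨x, hx⟩ : T.Nonempty := hsne.image _
        have := hTH hx
        rw [← he] at this
        simp [hx] at this
    omega
  obtain ⟨F, hFi, hF⟩ := (all_card_le_biUnion_card_iff_exists_injective tt).1 hall
  have hF' : ∀ q, (F q ∈ pairsIn G A H) ∧ ((F q).1 = q.1 ∨ (F q).2 = q.1) := fun q => by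
    simpa [tt] using hF q
  have hp : ∀ p ∈ pairsIn G A H, p.1 ∈ H ∧ p.2 ∈ H ∧ p.1 ∈ A ∧ G.Adj p.1 p.2 := by
    intro p hp
    simp only [pairsIn, mem_filter, mem_product] at hp
    tauto
  refine ⟨H, hHS, hHne, fun x y => ∃ q, (q.1 : V) = x ∧ (F q = (x, y) ∨ F q = (y, x)),
    ?_, ?_, ?_⟩
  · rintro x y ⟨q, hq, h⟩ ⟨q', hq', h'⟩
    have e1 := hp _ (hF' q).1
    have e2 := hp _ (hF' q').1
    have hne : x ≠ y := by
      rcases h with h | h <;> rw [h] at e1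
      · exact e1.2.2.2.ne
      · exact e1.2.2.2.ne'
    have hqq : F q = F q' := by
      rcases h with h | h <;> rcases h' with h' | h' <;> rw [h] at e1 ⊢ <;> rw [h'] at e2 ⊢
      · exact absurd e1.2.2.2 (hA _ e1.2.2.1 _ e2.2.2.1)
      · exact absurd e1.2.2.2 (hA _ e1.2.2.1 _ e2.2.2.1)
    have := hFi hqq
    subst this
    exact hne (hq.symm.trans hq')
  · rintro x y ⟨q, hq, h⟩
    have e1 := hp _ (hF' q).1
    rcases h with h | h <;> rw [h] at e1
    · exact ⟨e1.2.2.2, Or.inl e1.2.2.1⟩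
    · exact ⟨e1.2.2.2.symm, Or.inr e1.2.2.1⟩
  · intro x hx
    let o : Fin (g x).toNat → V := fun i =>
      if (F ⟨⟨x, hx⟩, i⟩).1 = x then (F ⟨⟨x, hx⟩, i⟩).2 else (F ⟨⟨x, hx⟩, i⟩).1
    have ho : ∀ i, F ⟨⟨x, hx⟩, i⟩ = (x, o i) ∨ F ⟨⟨x, hx⟩, i⟩ = (o i, x) := by
      intro i
      by_cases h : (F ⟨⟨x, hx⟩, i⟩).1 = x
      · left
        simp only [o, h, if_true]
        exact Prod.ext h rfl
      · right
        simp only [o, h, if_false]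
        exact Prod.ext rfl ((hF' ⟨⟨x, hx⟩, i⟩).2.resolve_left h)
    have hoi : Function.Injective o := by
      intro i j hij
      have e1 := hp _ (hF' ⟨⟨x, hx⟩, i⟩).1
      have e2 := hp _ (hF' ⟨⟨x, hx⟩, j⟩).1
      have : F ⟨⟨x, hx⟩, i⟩ = F ⟨⟨x, hx⟩, j⟩ := by
        rcases ho i with h | h <;> rcases ho j with h' | h' <;> rw [h] at e1 ⊢ <;>
          rw [h'] at e2 ⊢ <;> rw [hij] at *
        · exact absurd e1.2.2.2 (hA _ e1.2.2.1 _ e2.2.2.1)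
        · exact absurd e1.2.2.2 (hA _ e1.2.2.1 _ e2.2.2.1)
      have := hFi this
      simpa using this
    have hsub : (univ : Finset (Fin (g x).toNat)).image o ⊆
        H.filter (fun y => ∃ q, (q.1 : V) = x ∧ (F q = (x, y) ∨ F q = (y, x))) := by
      intro y hy
      obtain ⟨i, _, rfl⟩ := mem_image.1 hy
      have e1 := hp _ (hF' ⟨⟨x, hx⟩, i⟩).1
      refine mem_filter.2 ⟨?_, ⟨⟨x, hx⟩, i⟩, rfl, ho i⟩
      rcases ho i with h | h <;> rw [h] at e1
      · exact e1.2.1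
      · exact e1.1
    have := card_le_card hsub
    rw [card_image_of_injective _ hoi, card_univ, Fintype.card_fin] at this
    refine le_trans (b := ((H.filter (fun y =>
      ∃ q, (q.1 : V) = x ∧ (F q = (x, y) ∨ F q = (y, x)))).card : ℤ)) (by omega)
      (le_of_eq (by congr))

lemma sum_card_powerset_aux {V : Type*} [DecidableEq V] (X : Finset V) :
    2 * ∑ Y ∈ X.powerset, Y.card = X.card * 2 ^ X.card := by
  induction X using Finset.induction_on with
  | empty => simp
  | insert a s ha ih =>
    rw [sum_powerset_insert ha, card_insert_of_notMem ha]
    have : ∑ Y ∈ s.powerset, (insert a Y).card = ∑ Y ∈ s.powerset, (Y.card + 1) :=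
      sum_congr rfl fun Y hY => card_insert_of_notMem fun h => ha (mem_powerset.1 hY h)
    rw [this, sum_add_distrib, sum_const, card_powerset, smul_eq_mul, mul_one, pow_succ]
    linarith

lemma numeric_aux (m x d : ℕ) (hd : 2 ^ m ≤ d) : m * (2 ^ x + 1) ≤ 2 * d + x * 2 ^ x := by
  have hm : m ≤ 2 ^ m := Nat.lt_two_pow_self.le
  rcases le_total m x with h | h
  · have := Nat.mul_le_mul_right (2 ^ x) h
    linarith
  · obtain ⟨i, rfl⟩ := Nat.exists_eq_add_of_le h
    have hi : i ≤ 2 ^ i := Nat.lt_two_pow_self.le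
    have h2 := Nat.mul_le_mul_left (2 ^ x) hi
    rw [← pow_add] at h2
    nlinarith

open Classical in
/-- The contribution of a vertex, summed over all independent sets. -/
lemma vertex_contrib {V : Type*} (G : SimpleGraph V) (htf : G.CliqueFree 3)
    (S : Finset V) (v : V) (hv : v ∈ S) (m : ℕ)
    (hm : 2 ^ m ≤ (S.filter (G.Adj v)).card) (I : Finset (Finset V))
    (hI : I = S.powerset.filter (fun W => ∀ x ∈ W, ∀ y ∈ W, ¬ G.Adj x y)) :
    m * I.card ≤ 2 * ∑ W ∈ I, ((if v ∈ W then (S.filter (G.Adj v)).card else 0)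
      + (W.filter (G.Adj v)).card) := by
  set d := (S.filter (G.Adj v)).card with hd
  let φ : Finset V → Finset V := fun W => W.filter (fun u => u ≠ v ∧ ¬ G.Adj v u)
  have hmemI : ∀ W, W ∈ I ↔ W ⊆ S ∧ ∀ x ∈ W, ∀ y ∈ W, ¬ G.Adj x y := by
    intro W; simp [hI]
  rw [card_eq_sum_card_image φ I, mul_sum, ← sum_fiberwise_of_maps_to (s := I)
    (t := I.image φ) (g := φ) (fun W hW => mem_image_of_mem φ hW), mul_sum]
  refine sum_le_sum fun U hU => ?_
  obtain ⟨W0, hW0, hW0U⟩ := mem_image.1 hU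
  rw [hmemI] at hW0
  have hU1 : ∀ u ∈ U, u ∈ S ∧ u ≠ v ∧ ¬ G.Adj v u := by
    intro u hu
    rw [← hW0U, mem_filter] at hu
    exact ⟨hW0.1 hu.1, hu.2⟩
  have hU2 : ∀ x ∈ U, ∀ y ∈ U, ¬ G.Adj x y := by
    intro x hx y hy
    rw [← hW0U, mem_filter] at hx hy
    exact hW0.2 x hx.1 y hy.1
  let X : Finset V := S.filter (fun u => G.Adj v u ∧ ∀ w ∈ U, ¬ G.Adj u w)
  have hX : ∀ u, u ∈ X ↔ u ∈ S ∧ G.Adj v u ∧ ∀ w ∈ U, ¬ G.Adj u w := by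
    intro u; simp [X]
  have hfib : I.filter (fun W => φ W = U) =
      insert (insert v U) (X.powerset.image (fun Y => U ∪ Y)) := by
    ext W
    simp only [mem_filter, hmemI, mem_insert, mem_image, mem_powerset]
    constructor
    · rintro ⟨⟨hWS, hWi⟩, hWU⟩
      have hUW : ∀ u, u ∈ U ↔ u ∈ W ∧ u ≠ v ∧ ¬ G.Adj v u := by
        intro u; rw [← hWU]; simp [φ]
      by_cases hvW : v ∈ W
      · left
        ext u
        rw [mem_insert, hUW]
        constructor
        · intro hu
          by_cases h : u = v
          · exact Or.inl h
          · exact Or.inr ⟨hu, h, hWi v hvW u hu⟩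
        · rintro (rfl | h)
          · exact hvW
          · exact h.1
      · right
        refine ⟨W.filter (G.Adj v), ?_, ?_⟩
        · intro u hu
          rw [mem_filter] at hu
          exact (hX u).2 ⟨hWS hu.1, hu.2, fun w hw => hWi u hu.1 w ((hUW w).1 hw).1⟩
        · ext u
          rw [mem_union, hUW, mem_filter]
          constructor
          · rintro (h | h) <;> exact h.1
          · intro hu
            by_cases h : G.Adj v u
            · exact Or.inr ⟨hu, h⟩
            · exact Or.inl ⟨hu, fun e => hvW (e ▸ hu), h⟩
    · rintro (rfl | ⟨Y, hY, rfl⟩)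
      · refine ⟨⟨?_, ?_⟩, ?_⟩
        · intro u hu
          rcases mem_insert.1 hu with rfl | hu
          · exact hv
          · exact (hU1 u hu).1
        · intro x hx y hy
          rcases mem_insert.1 hx with rfl | hx <;> rcases mem_insert.1 hy with rfl | hy
          · exact G.irrefl
          · exact (hU1 y hy).2.2
          · exact fun h => (hU1 x (by assumption)).2.2 h.symm
          · exact hU2 x hx y hy
        · ext u
          simp only [φ, mem_filter, mem_insert]
          constructor
          · rintro ⟨h | h, h'⟩
            · exact absurd h h'.1
            · exact h
          · exact fun h => ⟨Or.inr h, (hU1 u h).2⟩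
      · refine ⟨⟨?_, ?_⟩, ?_⟩
        · intro u hu
          rcases mem_union.1 hu with hu | hu
          · exact (hU1 u hu).1
          · exact ((hX u).1 (hY hu)).1
        · intro x hx y hy
          rcases mem_union.1 hx with hx | hx <;> rcases mem_union.1 hy with hy | hy
          · exact hU2 x hx y hy
          · exact fun h => ((hX y).1 (hY hy)).2.2 x hx h.symm
          · exact ((hX x).1 (hY hx)).2.2 y hy
          · intro hxy
            exact htf {v, x, y} (is3Clique_triple_iff.2
              ⟨((hX x).1 (hY hx)).2.1, ((hX y).1 (hY hy)).2.1, hxy⟩)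
        · ext u
          simp only [φ, mem_filter, mem_union]
          constructor
          · rintro ⟨h | h, h'⟩
            · exact h
            · exact absurd ((hX u).1 (hY h)).2.1 h'.2
          · exact fun h => ⟨Or.inl h, (hU1 u h).2⟩
  have hvU : v ∉ U := fun h => (hU1 v h).2.1 rfl
  have hvX : v ∉ X := fun h => G.irrefl ((hX v).1 h).2.1
  have hdisj : ∀ Y ⊆ X, ∀ u ∈ Y, u ∉ U := fun Y hY u hu h =>
    (hU1 u h).2.2 ((hX u).1 (hY hu)).2.1
  have hnot : insert v U ∉ X.powerset.image (fun Y => U ∪ Y) := by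
    intro h
    obtain ⟨Y, hY, he⟩ := mem_image.1 h
    have : v ∈ U ∪ Y := by rw [he]; exact mem_insert_self _ _
    rcases mem_union.1 this with h | h
    · exact hvU h
    · exact hvX (mem_powerset.1 hY h)
  have hfilt : ∀ Y ⊆ X, (U ∪ Y).filter (G.Adj v) = Y := by
    intro Y hY
    ext u
    rw [mem_filter, mem_union]
    constructor
    · rintro ⟨h | h, h'⟩
      · exact absurd h' (hU1 u h).2.2
      · exact h
    · exact fun h => ⟨Or.inr h, ((hX u).1 (hY h)).2.1⟩
  have hinj : Set.InjOn (fun Y => U ∪ Y) (X.powerset : Set (Finset V)) := by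
    intro Y hY Z hZ he
    have hY := mem_powerset.1 (mem_coe.1 hY)
    have hZ := mem_powerset.1 (mem_coe.1 hZ)
    rw [← hfilt Y hY, ← hfilt Z hZ]
    exact congrArg _ he
  rw [hfib, card_insert_of_notMem hnot, sum_insert hnot, card_image_of_injOn hinj,
    sum_image hinj, card_powerset, if_pos (mem_insert_self _ _)]
  have hsum : ∑ Y ∈ X.powerset, ((if v ∈ U ∪ Y then d else 0)
      + ((U ∪ Y).filter (G.Adj v)).card) = ∑ Y ∈ X.powerset, Y.card := by
    refine sum_congr rfl fun Y hY => ?_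
    have hY := mem_powerset.1 hY
    rw [hfilt Y hY, if_neg, zero_add]
    intro h
    rcases mem_union.1 h with h | h
    · exact hvU h
    · exact hvX (hY h)
  rw [hsum]
  have h1 := sum_card_powerset_aux X
  have h2 := numeric_aux m X.card d hm
  have h3 : 2 * d + 2 * ∑ Y ∈ X.powerset, Y.card ≤ 2 * (d + ((insert v U).filter (G.Adj v)).card
    + ∑ Y ∈ X.powerset, Y.card) := by linarith [Nat.zero_le ((insert v U).filter (G.Adj v)).card]
  linarith

open Classical in
lemma exists_indep {V : Type*} (G : SimpleGraph V) (htf : G.CliqueFree 3)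
    (S : Finset V) (g : V → ℤ)
    (hg : ∀ v ∈ S, 0 < g v → 2 ^ (4 * (g v).toNat) ≤ (S.filter (G.Adj v)).card) :
    ∃ A ⊆ S, (∀ x ∈ A, ∀ y ∈ A, ¬ G.Adj x y) ∧ ∑ v ∈ S, g v ≤ (pairsIn G A S).card := by
  obtain ⟨I, hI⟩ : ∃ I, I = S.powerset.filter (fun W => ∀ x ∈ W, ∀ y ∈ W, ¬ G.Adj x y) :=
    ⟨_, rfl⟩
  have hmemI : ∀ W, W ∈ I ↔ W ⊆ S ∧ ∀ x ∈ W, ∀ y ∈ W, ¬ G.Adj x y := by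
    intro W; simp [hI]
  have hIne : I.Nonempty := ⟨∅, by simp [hmemI]⟩
  have hpairs : ∀ W ∈ I, 2 * (pairsIn G W S).card =
      ∑ v ∈ S, ((if v ∈ W then (S.filter (G.Adj v)).card else 0)
      + (W.filter (G.Adj v)).card) := by
    intro W hW
    have hWS := ((hmemI W).1 hW).1
    have e1 : (pairsIn G W S).card =
        ∑ v ∈ S, (if v ∈ W then (S.filter (G.Adj v)).card else 0) := by
      rw [pairsIn, card_filter, sum_product]
      refine sum_congr rfl fun v hv => ?_
      by_cases h : v ∈ W
      · simp [h]
      · simp [h]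
    have e2 : (pairsIn G W S).card = ∑ v ∈ S, (W.filter (G.Adj v)).card := by
      rw [pairsIn, card_filter, sum_product_right]
      refine sum_congr rfl fun v hv => ?_
      rw [← card_filter]
      congr 1
      ext u
      simp only [mem_filter]
      constructor
      · rintro ⟨_, h, h'⟩; exact ⟨h, h'.symm⟩
      · rintro ⟨h, h'⟩; exact ⟨hWS h, h, h'.symm⟩
    rw [sum_add_distrib, ← e1, ← e2, two_mul]
  have hkey : ∑ W ∈ I, (∑ v ∈ S, g v) ≤ ∑ W ∈ I, ((pairsIn G W S).card : ℤ) := by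
    have h1 : ∀ v ∈ S, 4 * (g v * I.card) ≤
        2 * ∑ W ∈ I, (((if v ∈ W then (S.filter (G.Adj v)).card else 0)
          + (W.filter (G.Adj v)).card : ℕ) : ℤ) := by
      intro v hv
      rcases le_or_gt (g v) 0 with h | h
      · have a1 : g v * I.card ≤ 0 := mul_nonpos_of_nonpos_of_nonneg h (by positivity)
        have a2 : (0 : ℤ) ≤ 2 * ∑ W ∈ I, (((if v ∈ W then (S.filter (G.Adj v)).card else 0)
          + (W.filter (G.Adj v)).card : ℕ) : ℤ) := by positivity
        linarith
      · have := vertex_contrib G htf S v hv _ (hg v hv h) I hI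
        zify at this
        rw [Int.toNat_of_nonneg h.le] at this
        push_cast at this ⊢
        linarith
    have h2 := sum_le_sum h1
    rw [← mul_sum, ← sum_mul, ← mul_sum, sum_comm] at h2
    have h3 : ∑ W ∈ I, ∑ v ∈ S, (((if v ∈ W then (S.filter (G.Adj v)).card else 0)
          + (W.filter (G.Adj v)).card : ℕ) : ℤ) = ∑ W ∈ I, 2 * ((pairsIn G W S).card : ℤ) := by
      refine sum_congr rfl fun W hW => ?_
      have := hpairs W hW
      exact_mod_cast this.symm
    rw [h3, ← mul_sum] at h2
    rw [sum_const, nsmul_eq_mul]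
    linarith
  obtain ⟨A, hA, hA'⟩ := exists_le_of_sum_le hIne hkey
  exact ⟨A, ((hmemI A).1 hA).1, ((hmemI A).1 hA).2, hA'⟩

open Classical in
lemma color_all {V : Type*} (G : SimpleGraph V) (htf : G.CliqueFree 3)
    (L : V → Finset ℕ)
    (hL : ∀ S : Finset V, ∀ v ∈ S,
      0 < ((S.filter (G.Adj v)).card : ℤ) + 1 - (L v).card →
      2 ^ (4 * (((S.filter (G.Adj v)).card : ℤ) + 1 - (L v).card).toNat)
        ≤ (S.filter (G.Adj v)).card) (S : Finset V) :
    ∃ c : V → ℕ, (∀ v ∈ S, c v ∈ L v) ∧ ∀ x ∈ S, ∀ y ∈ S, G.Adj x y → c x ≠ c y := by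
  induction S using Finset.strongInduction with
  | H S ih =>
    rcases S.eq_empty_or_nonempty with rfl | hS
    · exact ⟨fun _ => 0, by simp, by simp⟩
    obtain ⟨A, hAS, hA, hAg⟩ := exists_indep G htf S
      (fun v => ((S.filter (G.Adj v)).card : ℤ) + 1 - (L v).card) (hL S)
    obtain ⟨H, hHS, ⟨h0, hh0⟩, R, hR1, hR2, hR3⟩ := exists_orient G A S hA hS _ hAg
    obtain ⟨c, hc, hcp⟩ := ih (S \ H)
      (by
        refine ⟨sdiff_subset, fun h => ?_⟩
        have := h (hHS hh0)
        simp [hh0] at this)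
    obtain ⟨c', hc', hcp'⟩ := kernel_color G A (fun x y => ¬ R x y) hA
      (by
        intro x y _
        by_contra h
        push Not at h
        exact hR1 x y h.1 h.2)
      (by
        intro x y hx hy h
        rcases (hR2 x y h).2 with h | h
        · exact hx h
        · exact hy h)
      H (fun v => L v \ ((S \ H).filter (G.Adj v)).image c)
      (by
        intro v hv
        have h1 := hR3 v hv
        have h2 := le_card_sdiff (((S \ H).filter (G.Adj v)).image c) (L v)
        have h3 : (((S \ H).filter (G.Adj v)).image c).card ≤ ((S \ H).filter (G.Adj v)).card :=
          card_image_le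
        have h4 : (S.filter (G.Adj v)).card =
            ((S \ H).filter (G.Adj v)).card + (H.filter (G.Adj v)).card := by
          rw [← card_union_of_disjoint, ← filter_union, sdiff_union_of_subset hHS]
          exact disjoint_filter_filter sdiff_disjoint
        have h5 : (H.filter (G.Adj v)).card =
            (H.filter (fun y => R v y)).card + (H.filter (fun y => G.Adj v y ∧ ¬ R v y)).card := by
          rw [← card_union_of_disjoint]
          · congr 1
            ext u
            simp only [mem_filter, mem_union]
            have := hR2 v u
            tauto
          · rw [Finset.disjoint_left]
            intro u hu hu'
            simp only [mem_filter] at hu hu'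
            tauto
        refine lt_of_le_of_lt (b := (H.filter (fun y => G.Adj v y ∧ ¬ R v y)).card)
          (le_of_eq (by congr)) ?_
        omega)
    have hne : ∀ x ∈ H, ∀ y ∈ S, y ∉ H → G.Adj x y → c' x ≠ c y := by
      intro x hx y hy hyH hxy he
      have := (mem_sdiff.1 (hc' x hx)).2
      exact this (mem_image.2 ⟨y, by simp [hy, hyH, hxy], he.symm⟩)
    refine ⟨fun v => if v ∈ H then c' v else c v, ?_, ?_⟩
    · intro v hv
      by_cases h : v ∈ H
      · simp only [h, if_true]
        exact (mem_sdiff.1 (hc' v h)).1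
      · simp only [h, if_false]
        exact hc v (mem_sdiff.2 ⟨hv, h⟩)
    · intro x hx y hy hxy
      by_cases h : x ∈ H <;> by_cases h' : y ∈ H <;> simp only [h, h', if_true, if_false]
      · exact hcp' x h y h' hxy
      · exact hne x h y hy h' hxy
      · exact (hne y h' x hx h hxy.symm).symm
      · exact hcp x (mem_sdiff.2 ⟨hx, h⟩) y (mem_sdiff.2 ⟨hy, h'⟩) hxy

lemma pow_shift (j i : ℕ) : 2 ^ (4 * j) + i ≤ 2 ^ (4 * (j + i)) := by
  induction i with
  | zero => simp
  | succ n ih =>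
    have h1 : 2 ^ (4 * (j + (n + 1))) = 16 * 2 ^ (4 * (j + n)) := by
      rw [← add_assoc, mul_add, pow_add]; norm_num [mul_comm]
    have h2 : 0 < 2 ^ (4 * (j + n)) := by positivity
    omega

/-- Every triangle-free graph `G` with `Δ(G) ≤ t` is
`(t + 1 - ⌊(1/4)·log₂ t⌋)`-choosable. -/
theorem triangle_free_choosable {V : Type*} [Fintype V] [DecidableEq V]
    (G : SimpleGraph V) [DecidableRel G.Adj]
    (htf : G.CliqueFree 3) (t : ℕ) (ht : G.maxDegree ≤ t) :
    Choosable G (fun _ => (t : ℤ) + 1 - ⌊(1 / 4 : ℝ) * Real.logb 2 t⌋) := by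
  intro L hL
  have hk : ∃ k : ℕ, ⌊(1 / 4 : ℝ) * Real.logb 2 t⌋ = k ∧ (k = 0 ∨ 2 ^ (4 * k) ≤ t) := by
    rcases Nat.eq_zero_or_pos t with rfl | htpos
    · exact ⟨0, by simp, Or.inl rfl⟩
    have ht1 : (1 : ℝ) ≤ t := by exact_mod_cast htpos
    have h0 : 0 ≤ ⌊(1 / 4 : ℝ) * Real.logb 2 t⌋ := by
      apply Int.floor_nonneg.2
      have := Real.logb_nonneg (b := 2) (by norm_num) ht1
      positivity
    obtain ⟨k, hk⟩ := Int.eq_ofNat_of_zero_le h0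
    refine ⟨k, hk, Or.inr ?_⟩
    have h1 := Int.floor_le ((1 / 4 : ℝ) * Real.logb 2 t)
    rw [hk] at h1
    have h2 : ((4 * k : ℕ) : ℝ) ≤ Real.logb 2 t := by push_cast at h1 ⊢; linarith
    rw [Real.le_logb_iff_rpow_le (by norm_num) (by linarith), Real.rpow_natCast] at h2
    exact_mod_cast h2
  obtain ⟨k, hk, hkt⟩ := hk
  simp only [hk] at hL
  obtain ⟨c, hc, hcp⟩ := color_all G htf L (by
    intro S v hv
    rw [hL v]
    generalize hdd : (@filter V (G.Adj v) (fun a => Classical.propDecidable _) S).card = d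
    have hdt : d ≤ t := by
      refine le_trans ?_ ((G.degree_le_maxDegree v).trans ht)
      rw [← hdd, ← card_neighborFinset_eq_degree]
      apply card_le_card
      intro u hu
      simp only [mem_filter] at hu
      simpa using hu.2
    intro hpos
    obtain ⟨j, hj⟩ : ∃ j : ℕ, (d : ℤ) + 1 - (t + 1 - k) = j := ⟨_, (Int.toNat_of_nonneg hpos.le).symm⟩
    rw [hj, Int.toNat_natCast]
    have h1 := pow_shift j (t - d)
    have h2 : j + (t - d) = k := by omega
    rw [h2] at h1
    rcases hkt with h | h
    · omega
    · omega) univ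
  exact ⟨c, fun v => hc v (mem_univ _), fun x y h => hcp x (mem_univ _) y (mem_univ _) h⟩
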